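/- Let α = (α_1, …, α_k) be a composition of positive integers for which there exists J with 1 ≤ J ≤ k such that α_ℓ ≥ ℓ for 1 ≤ ℓ ≤ J and α_ℓ = J for J + 1 ≤ ℓ ≤ k. Then I_α = Σ_{σ ∈ S_k} sign(σ) · R_{(α_1 − 1 + σ_1, α_2 − 2 + σ_2, …, α_k − k + σ_k)}, with the convention that R_β = 0 whenever β contains a part ≤ 0. (In particular this covers all rectangles α = (m^k) and all stacked rectangles (a^b, c^d) with b ≤ c and b ≤ a.) -/

import Mathlib

open scoped BigOperators

/-- NSym modeled as the free noncommutative ℚ-algebra on generators indexed by ℕ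
(the generator `n` playing the role of `H_n` for `n ≥ 1`). -/
abbrev NSym : Type := FreeAlgebra ℚ ℕ

/-- The complete homogeneous noncommutative symmetric functions, extended to ℤ:
`H 0 = 1`, `H n = 0` for `n < 0`, and `H n` the `n`-th generator for `n ≥ 1`. -/
noncomputable def H (n : ℤ) : NSym :=
  if n < 0 then 0 else if n = 0 then 1 else FreeAlgebra.ι ℚ n.toNat

/-- `DecFrom k r ν` : `ν_r ≥ ν_{r+1} ≥ … ≥ ν_k` (1-based indexing). -/
def DecFrom (k r : ℕ) (ν : ℕ → ℕ) : Prop :=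
  ∀ i, r ≤ i → i < k → ν (i + 1) ≤ ν i

/-- `(p,q)` is a boundary cell of the partial GBPR diagram `D^{(r-1)}_{μ/ν}`. -/
def IsBoundary (k r : ℕ) (μ : ℕ → ℤ) (ν : ℕ → ℕ) (p q : ℕ) : Prop :=
  r ≤ p ∧ p ≤ k ∧
    (if p = r then
      ν r + 1 ≤ q ∧ (q : ℤ) ≤ max ((ν r : ℤ) + 1) (max (μ r) (2 * (ν r : ℤ) - μ r))
    else
      ν p + 1 ≤ q ∧ q ≤ ν (p - 1) + 1)

/-- `(p,q)` is a tunnel cell of `D^{(r-1)}_{μ/ν}`. -/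
def IsTunnel (k r : ℕ) (μ : ℕ → ℤ) (ν : ℕ → ℕ) (p q : ℕ) : Prop :=
  IsBoundary k r μ ν p q ∧ q = ν p + 1

/-- The set of boundary cells of `D^{(r-1)}_{μ/ν}` not tunnel cells. -/
def IsN (k r : ℕ) (μ : ℕ → ℤ) (ν : ℕ → ℕ) (p q : ℕ) : Prop :=
  IsBoundary k r μ ν p q ∧ ¬ IsTunnel k r μ ν p q

/-- The tunnel hook `h(r,τ)` for a tunnel cell `τ = (p,q)` of `D^{(r-1)}_{μ/ν}`:
all boundary cells in rows `r` through `p`. -/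
def hook (k r : ℕ) (μ : ℕ → ℤ) (ν : ℕ → ℕ) (p : ℕ) : Set (ℕ × ℕ) :=
  {c : ℕ × ℕ | IsBoundary k r μ ν c.1 c.2 ∧ c.1 ≤ p}

/-- The value `Δ(h(r,τ)) = (μ_r − ν_r) + (ν_r + 1 − q) + (p − r)` for `τ = (p,q)`. -/
def hookDelta (μ : ℕ → ℤ) (ν : ℕ → ℕ) (r p q : ℕ) : ℤ :=
  (μ r - (ν r : ℤ)) + (((ν r : ℤ) + 1) - (q : ℤ)) + ((p : ℤ) - (r : ℤ))

/-- The update `ν ↦ ν^{(r)}`: `ν'_i = ν_{i-1} + 1` for `r < i ≤ p`, else `ν'_i = ν_i`. -/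
def nuUpdate (ν : ℕ → ℕ) (r p : ℕ) : ℕ → ℕ := fun i =>
  if r < i ∧ i ≤ p then ν (i - 1) + 1 else ν i

/-- The sequence `ν^{(0)}, ν^{(1)}, …` of intermediate shapes of a tunnel hook covering
with terminal rows `p 1, p 2, …`. -/
def nuSeq (ν₀ : ℕ → ℕ) (p : ℕ → ℕ) : ℕ → ℕ → ℕ
  | 0 => ν₀
  | r + 1 => nuUpdate (nuSeq ν₀ p r) (r + 1) (p (r + 1))

/-- A tunnel hook covering of `D_{μ/ν₀}` : for each `r = 1, …, k` a tunnel cell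
`(p r, q r)` of `D^{(r-1)}_{μ/ν^{(r-1)}}` (values outside `1 ≤ r ≤ k` normalized to `0`). -/
structure THC (k : ℕ) (μ : ℕ → ℤ) (ν₀ : ℕ → ℕ) where
  p : ℕ → ℕ
  q : ℕ → ℕ
  tunnel : ∀ r, 1 ≤ r → r ≤ k → IsTunnel k r μ (nuSeq ν₀ p (r - 1)) (p r) (q r)
  p_out : ∀ r, r = 0 ∨ k < r → p r = 0
  q_out : ∀ r, r = 0 ∨ k < r → q r = 0

/-- Row-ordered noncommutative determinant (Laplace expansion from the top row down). -/
noncomputable def ndet {k : ℕ} (A : Fin k → Fin k → NSym) : NSym :=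
  ∑ σ : Equiv.Perm (Fin k),
    ((Equiv.Perm.sign σ : ℤ) • (List.ofFn fun i => A i (σ i)).prod)

/-- The immaculate function `I_μ = ndet (H_{μ_i + j − i})` (1-based `μ`). -/
noncomputable def Imm (k : ℕ) (μ : ℕ → ℤ) : NSym :=
  ndet fun i j : Fin k => H (μ (i.1 + 1) + ((j.1 : ℤ) + 1) - ((i.1 : ℤ) + 1))

/-- The skew immaculate function `I_{μ/ν} = ndet (H_{(μ_i − i) − (ν_j − j)})`. -/
noncomputable def ImmSkew (k : ℕ) (μ ν : ℕ → ℤ) : NSym :=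
  ndet fun i j : Fin k =>
    H ((μ (i.1 + 1) - ((i.1 : ℤ) + 1)) - (ν (j.1 + 1) - ((j.1 : ℤ) + 1)))

/-- The signed product `∏_{r=1}^{k} ε(h(r,τ_r)) H_{Δ(h(r,τ_r))}` attached to a
tunnel hook covering, the product taken in the order `r = 1, …, k`. -/
noncomputable def thcTerm (k : ℕ) (μ : ℕ → ℤ) (ν₀ : ℕ → ℕ) (γ : THC k μ ν₀) : NSym :=
  (List.ofFn fun r : Fin k =>
    (-1 : NSym) ^ (γ.p (r.1 + 1) - (r.1 + 1)) *
      H (hookDelta μ (nuSeq ν₀ γ.p r.1) (r.1 + 1) (γ.p (r.1 + 1)) (γ.q (r.1 + 1)))).prod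
/-- Two cells are adjacent iff their taxicab distance is 1. -/
def Adj (c d : ℕ × ℕ) : Prop :=
  ((c.1 : ℤ) - (d.1 : ℤ)).natAbs + ((c.2 : ℤ) - (d.2 : ℤ)).natAbs = 1

/-- A set of cells is connected: any two of its cells are joined by a chain of
cells of the set in which consecutive cells are adjacent. -/
def ConnectedSet (C : Set (ℕ × ℕ)) : Prop :=
  ∀ c ∈ C, ∀ d ∈ C, ∃ l : List (ℕ × ℕ),
    l.head? = some c ∧ l.getLast? = some d ∧ (∀ x ∈ l, x ∈ C) ∧ l.Chain' Adj

/-- `m_r = #{ i < r : σ_i > σ_r }`. -/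
def mcount {k : ℕ} (σ : Equiv.Perm (Fin k)) (r : Fin k) : ℕ :=
  (Finset.univ.filter fun i : Fin k => i < r ∧ σ r < σ i).card

/-- The set `{σ_{r+1}, …, σ_k}` of one-line (1-based) values of `σ` at positions `> r`. -/
def onelineTail {k : ℕ} (σ : Equiv.Perm (Fin k)) (r : ℕ) : Finset ℕ :=
  (Finset.univ.filter fun i : Fin k => r < i.1 + 1).image fun i => (σ i).1 + 1

/-- `beta σ r t` : the `t`-th smallest element of `{σ_{r+1}, …, σ_k}`. -/
def beta {k : ℕ} (σ : Equiv.Perm (Fin k)) (r t : ℕ) : ℕ :=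
  ((onelineTail σ r).sort (· ≤ ·)).getD (t - 1) 0

/-- The exponent `δ` in the sign of a linear permutation `π ∈ A_{k,m}`. -/
def lpInv {k m : ℕ} (π : Fin m ↪ Fin k) : ℕ :=
  (Finset.univ.filter fun p : Fin m × Fin m => p.1 < p.2 ∧ π p.2 < π p.1).card +
  (Finset.univ.filter fun p : Fin m × Fin k => (∀ t, π t ≠ p.2) ∧ p.2 < π p.1).card

/-- `betaC π j` : the `j`-th smallest element of `{1,…,k} ∖ {π_1,…,π_m}` (1-based values). -/
def betaC {k m : ℕ} (π : Fin m ↪ Fin k) (j : ℕ) : ℕ :=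
  (((Finset.univ.filter fun q : Fin k => ∀ t, π t ≠ q).image fun q => q.1 + 1).sort
    (· ≤ ·)).getD (j - 1) 0

/-- Coarsening `Θ(α,S)` of a sequence: replace the comma at each position in `S`
(1-based; position `i` lies between parts `i` and `i+1`) by addition. -/
def theta {α : Type} [Add α] (S : Finset ℕ) : ℕ → List α → List α
  | _, [] => []
  | _, [a] => [a]
  | i, a :: b :: rest =>
      if i ∈ S then theta S (i + 1) ((a + b) :: rest)
      else a :: theta S (i + 1) (b :: rest)
  termination_by i l => l.length

noncomputable def Hlist (β : List ℤ) : NSym := (β.map H).prod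

/-- The ribbon function `R_β = Σ_{γ ⪰ β} (−1)^{ℓ(β)−ℓ(γ)} H_γ`, with `R_β = 0`
whenever `β` has a part `≤ 0`. -/
noncomputable def Ribbon (β : List ℤ) : NSym :=
  if ∀ x ∈ β, 0 < x then
    ∑ S ∈ (Finset.Icc 1 (β.length - 1)).powerset,
      (-1 : NSym) ^ (β.length - (theta S 1 β).length) * Hlist (theta S 1 β)
  else 0


def lap : List ℤ → (ℤ → List ℤ → NSym) → NSym
  | [], _ => 0
  | a :: L, f => f a L - lap L (fun b M => f b (a :: M))

lemma lap_congr (L : List ℤ) : ∀ (f g : ℤ → List ℤ → NSym),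
    (∀ a M, a ∈ L → M.Sublist L → M.length + 1 = L.length → f a M = g a M) →
    lap L f = lap L g := by
  induction L with
  | nil => intro f g _; rfl
  | cons x L ih =>
    intro f g h
    simp only [lap]
    rw [h x L (by simp) (by simp) (by simp)]
    congr 1
    apply ih
    intro a M ha hM hl
    exact h a (x :: M) (by simp [ha]) (by simpa using hM) (by simpa using hl)

lemma lap_zero (L : List ℤ) : lap L (fun _ _ => 0) = 0 := by
  induction L with
  | nil => rfl
  | cons x L ih => simp [lap, ih]

lemma lap_eq_zero (L : List ℤ) (f : ℤ → List ℤ → NSym)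
    (h : ∀ a M, a ∈ L → M.Sublist L → M.length + 1 = L.length → f a M = 0) :
    lap L f = 0 := by
  rw [lap_congr L f (fun _ _ => 0) h, lap_zero]

lemma lap_sub (L : List ℤ) : ∀ (f g : ℤ → List ℤ → NSym),
    lap L (fun a M => f a M - g a M) = lap L f - lap L g := by
  induction L with
  | nil => intro f g; simp [lap]
  | cons x L ih => intro f g; simp only [lap, ih]; abel

lemma lap_mul (c : NSym) (L : List ℤ) : ∀ (f : ℤ → List ℤ → NSym),
    lap L (fun a M => c * f a M) = c * lap L f := by
  induction L with
  | nil => intro f; simp [lap]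
  | cons x L ih => intro f; simp only [lap, ih, mul_sub]

lemma lap_symm (L : List ℤ) : ∀ (g : ℤ → ℤ → List ℤ → NSym), (∀ a b N, g a b N = g b a N) →
    lap L (fun a M => lap M (fun b N => g a b N)) = 0 := by
  induction L with
  | nil => intro g _; rfl
  | cons x L ih =>
    intro g hg
    simp only [lap, lap_sub]
    rw [ih (fun a b N => g a b (x :: N)) (fun a b N => hg a b _)]
    rw [lap_congr L (fun a M => g a x M) (fun a M => g x a M) (fun a M _ _ _ => hg _ _ _)]
    simp

noncomputable def DD : List ℤ → List ℤ → NSym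
  | [], _ => 1
  | e :: E, A => lap A (fun a M => H (e + a) * DD E M)

noncomputable def Gp : List ℤ → ℤ → List ℤ → NSym
  | [], b, _ => H b
  | e :: E, b, A => lap A (fun a M =>
      if 0 < e + a then H b * Gp E (e + a) M - Gp E (b + (e + a)) M else 0)

noncomputable def GG : List ℤ → List ℤ → NSym
  | [], _ => 1
  | e :: E, A => lap A (fun a M => if 0 < e + a then Gp E (e + a) M else 0)

lemma Gp_cons (e : ℤ) (E : List ℤ) (b : ℤ) (A : List ℤ) :
    Gp (e :: E) b A = H b * GG (e :: E) A -
      lap A (fun a M => if 0 < e + a then Gp E (b + (e + a)) M else 0) := by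
  simp only [Gp, GG]
  rw [← lap_mul, ← lap_sub]
  apply lap_congr
  intro a M _ _ _
  split_ifs <;> simp

lemma Gp_zero (z : ℤ) (E : List ℤ) : ∀ (b : ℤ) (M : List ℤ), (∀ e ∈ E, e + z ≤ 0) →
    E.length = M.length + 1 → Gp E b (z :: M) = 0 := by
  induction E with
  | nil => intro b M _ h; simp at h
  | cons e E ih =>
    intro b M h hl
    have he := h e (by simp)
    simp only [Gp, lap]
    rw [if_neg (by omega), lap_eq_zero, sub_zero]
    intro a N ha hN hlN
    have hl' : E.length = N.length + 1 := by simp at hl; omega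
    rw [ih _ _ (fun e' he' => h e' (by simp [he'])) hl',
      ih _ _ (fun e' he' => h e' (by simp [he'])) hl']
    simp

lemma GG_zero (z : ℤ) (e : ℤ) (E : List ℤ) (M : List ℤ) (h : ∀ e' ∈ e :: E, e' + z ≤ 0)
    (hl : E.length = M.length) : GG (e :: E) (z :: M) = 0 := by
  have he := h e (by simp)
  simp only [GG, lap]
  rw [if_neg (by omega), lap_eq_zero, sub_zero]
  intro a N ha hN hlN
  rw [Gp_zero _ _ _ _ (fun e' he' => h e' (by simp [he'])) (by omega)]
  simp

lemma H_neg (n : ℤ) (h : n < 0) : H n = 0 := by simp [H, h]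

lemma H_zero : H 0 = 1 := by simp [H]

lemma DD_neg (z : ℤ) (E : List ℤ) : ∀ (M : List ℤ), (∀ e ∈ E, e + z < 0) →
    E.length = M.length + 1 → DD E (z :: M) = 0 := by
  induction E with
  | nil => intro M _ h; simp at h
  | cons e E ih =>
    intro M h hl
    have he := h e (by simp)
    simp only [DD, lap]
    rw [H_neg _ he, lap_eq_zero, sub_zero, zero_mul]
    intro a N ha hN hlN
    have hl' : E.length = N.length + 1 := by simp at hl; omega
    rw [ih _ (fun e' he' => h e' (by simp [he'])) hl', mul_zero]

lemma DD_z (z e : ℤ) (E : List ℤ) (M : List ℤ) (h0 : e + z = 0) (h : ∀ e' ∈ E, e' + z < 0)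
    (hl : E.length = M.length) : DD (e :: E) (z :: M) = DD E M := by
  simp only [DD, lap]
  rw [h0, H_zero, lap_eq_zero, sub_zero, one_mul]
  intro a N ha hN hlN
  rw [DD_neg _ _ _ h (by omega), mul_zero]

def Adm : ℤ → List ℤ → Prop
  | _, [] => True
  | t, e :: E => (-t ≤ e ∧ Adm t E) ∨
      (e = -(t + 1) ∧ (∀ e' ∈ E, e' < e) ∧ Adm (t + 1) E)

lemma GG_good (e : ℤ) (E : List ℤ) (A : List ℤ) (hg : ∀ a ∈ A, 0 < e + a) :
    GG (e :: E) A = lap A (fun a M => Gp E (e + a) M) := by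
  simp only [GG]
  apply lap_congr
  intro a M ha _ _
  rw [if_pos (hg a ha)]

lemma claim_good (e : ℤ) (E : List ℤ) (t : ℤ)
    (ih : ∀ (A : List ℤ) (c : ℤ), A.Pairwise (· < ·) → (∀ a ∈ A, t < a) →
      A.length = E.length + 1 →
      lap A (fun a M => Gp E (c + a) M) = lap A (fun a M => H (c + a) * DD E M))
    (A : List ℤ) (c : ℤ) (hs : A.Pairwise (· < ·)) (ht : ∀ a ∈ A, t < a)
    (hl : A.length = E.length + 2) (hg : ∀ a ∈ A, 0 < e + a) :
    lap A (fun a M => Gp (e :: E) (c + a) M) =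
      lap A (fun a M => H (c + a) * DD (e :: E) M) := by
  simp only [Gp_cons]
  rw [lap_sub]
  have h1 : lap A (fun a M => lap M
      (fun b N => if 0 < e + b then Gp E (c + a + (e + b)) N else 0)) = 0 := by
    rw [← lap_symm A (fun a b N => Gp E (c + a + (e + b)) N)
      (fun a b N => by congr 1; ring)]
    apply lap_congr
    intro a M ha hM _
    apply lap_congr
    intro b N hb _ _
    rw [if_pos (hg b (hM.subset hb))]
  rw [h1, sub_zero]
  apply lap_congr
  intro a M ha hM hlM
  rw [GG_good _ _ _ (fun b hb => hg b (hM.subset hb)),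
    ih M e (hs.sublist hM) (fun b hb => ht b (hM.subset hb)) (by omega)]
  rfl

lemma claim (E : List ℤ) : ∀ (t : ℤ) (A : List ℤ) (c : ℤ), Adm t E →
    A.Pairwise (· < ·) → (∀ a ∈ A, t < a) → A.length = E.length + 1 →
    lap A (fun a M => Gp E (c + a) M) = lap A (fun a M => H (c + a) * DD E M) := by
  induction E with
  | nil => intro t A c _ _ _ _; simp [Gp, DD]
  | cons e E ih =>
    intro t A c hA hs ht hl
    simp only [List.length_cons] at hl
    rcases hA with ⟨he, hA⟩ | ⟨he, hE, hA⟩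
    · exact claim_good e E t (fun A c h1 h2 h3 => ih t A c hA h1 h2 h3) A c hs ht (by omega)
        (fun a ha => by have := ht a ha; omega)
    · match A, hs, ht, hl with
      | [], _, _, hl => simp at hl
      | z :: A, hs, ht, hl =>
        rw [List.pairwise_cons] at hs
        obtain ⟨hz, hs⟩ := hs
        have hzt := ht z (by simp)
        simp only [List.length_cons] at hl
        by_cases hzz : z = t + 1
        · have hgood : ∀ a ∈ A, 0 < e + a := fun a ha => by have := hz a ha; omega
          have hEz : ∀ e' ∈ E, e' + z < 0 := fun e' he' => by have := hE e' he'; omega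
          have hlt : ∀ a ∈ A, t + 1 < a := fun a ha => by have := hz a ha; omega
          simp only [lap]
          rw [Gp_cons, GG_good _ _ _ hgood, ih (t + 1) A e hA hs hlt (by omega)]
          have e1 : lap A (fun a M => if 0 < e + a then Gp E (c + z + (e + a)) M else 0)
              = lap A (fun a M => H (c + a) * DD E M) := by
            rw [← ih (t + 1) A c hA hs hlt (by omega)]
            apply lap_congr
            intro a M ha _ _
            rw [if_pos (hgood a ha)]
            congr 1
            omega
          have e2 : lap A (fun a M => Gp (e :: E) (c + a) (z :: M)) = 0 := by
            apply lap_eq_zero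
            intro a M ha hM hlM
            apply Gp_zero
            · intro e' he'
              rcases List.mem_cons.1 he' with h | h
              · omega
              · exact (hEz e' h).le
            · simp only [List.length_cons]; omega
          have e3 : lap A (fun a M => H (c + a) * DD (e :: E) (z :: M))
              = lap A (fun a M => H (c + a) * DD E M) := by
            apply lap_congr
            intro a M ha hM hlM
            rw [DD_z z e E M (by omega) hEz (by omega)]
          rw [e1, e2, e3]
          simp only [DD, sub_zero]
        · have h2 : ∀ a ∈ z :: A, t + 1 < a := by
            intro a ha
            rcases List.mem_cons.1 ha with h | h
            · omega
            · have := hz a h; omega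
          exact claim_good e E (t + 1) (fun A c h1 h2 h3 => ih (t + 1) A c hA h1 h2 h3)
            (z :: A) c (List.pairwise_cons.2 ⟨hz, hs⟩) h2 (by simp; omega)
            (fun a ha => by have := h2 a ha; omega)

lemma GG_eq_DD (e : ℤ) (E : List ℤ) (A : List ℤ) (he : 0 ≤ e) (hA : Adm 0 E)
    (hs : A.Pairwise (· < ·)) (ht : ∀ a ∈ A, 0 < a) (hl : A.length = E.length + 1) :
    GG (e :: E) A = DD (e :: E) A := by
  rw [GG_good _ _ _ (fun a ha => by have := ht a ha; omega), claim E 0 A e hA hs ht hl]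
  rfl

/- Alternating sums. -/

def alt : ℕ → List ℤ → (List ℤ → NSym) → NSym
  | 0, _, F => F []
  | n + 1, L, F => lap L (fun a M => alt n M (fun w => F (a :: w)))

lemma lap_ofFn (n : ℕ) : ∀ (v : Fin (n + 1) → ℤ) (f : ℤ → List ℤ → NSym),
    lap (List.ofFn v) f =
      ∑ i : Fin (n + 1), ((-1 : ℤ) ^ (i : ℕ)) • f (v i) (List.ofFn fun j => v (i.succAbove j)) := by
  induction n with
  | zero => intro v f; simp [lap]
  | succ n ih =>
    intro v f
    rw [List.ofFn_succ]
    simp only [lap]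
    rw [ih, Fin.sum_univ_succ (n := n + 1), sub_eq_add_neg, ← Finset.sum_neg_distrib]
    congr 1
    · simp
    · apply Finset.sum_congr rfl
      intro i _
      rw [List.ofFn_succ (f := fun j => v (i.succ.succAbove j))]
      simp [pow_succ]

lemma perm_sum_succ (n : ℕ) (v : Fin (n + 1) → ℤ) (F : List ℤ → NSym) :
    ∑ σ : Equiv.Perm (Fin (n + 1)), (Equiv.Perm.sign σ : ℤ) • F (List.ofFn fun i => v (σ i)) =
    ∑ i : Fin (n + 1), ((-1 : ℤ) ^ (i : ℕ)) • ∑ τ : Equiv.Perm (Fin n),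
      (Equiv.Perm.sign τ : ℤ) • F (v i :: List.ofFn fun j => v (i.succAbove (τ j))) := by
  rw [← Equiv.sum_comp Equiv.Perm.decomposeFin.symm, Fintype.sum_prod_type]
  apply Finset.sum_congr rfl
  intro i _
  rw [Finset.smul_sum]
  refine Fin.cases ?_ (fun i => ?_) i
  · apply Finset.sum_congr rfl
    intro τ _
    simp [List.ofFn_succ]
  · conv_rhs => rw [← Equiv.sum_comp (Equiv.mulLeft (Fin.cycleRange i))]
    apply Finset.sum_congr rfl
    intro τ _
    have hpow : (-1 : ℤ) ^ (i : ℕ) * (-1) ^ (i : ℕ) = 1 := by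
      rw [← mul_pow]; simp
    have hs : (-1 : ℤ) ^ ((i.succ : Fin (n + 1)) : ℕ) *
        (Equiv.Perm.sign (Fin.cycleRange i * τ) : ℤ) =
        (Equiv.Perm.sign (Equiv.Perm.decomposeFin.symm (i.succ, τ)) : ℤ) := by
      simp only [Equiv.Perm.decomposeFin.symm_sign, Equiv.Perm.sign_mul, Fin.sign_cycleRange,
        Fin.succ_ne_zero, if_false, Fin.val_succ, pow_succ]
      push_cast
      linear_combination (-(Equiv.Perm.sign τ : ℤ)) * hpow
    rw [smul_smul, Equiv.coe_mulLeft, hs, List.ofFn_succ]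
    simp only [Equiv.Perm.mul_apply, Fin.succAbove_cycleRange,
      Equiv.Perm.decomposeFin_symm_apply_zero, Equiv.Perm.decomposeFin_symm_apply_succ]

lemma alt_perm (n : ℕ) : ∀ (v : Fin n → ℤ) (F : List ℤ → NSym),
    ∑ σ : Equiv.Perm (Fin n), (Equiv.Perm.sign σ : ℤ) • F (List.ofFn fun i => v (σ i)) =
      alt n (List.ofFn v) F := by
  induction n with
  | zero => intro v F; simp [alt]
  | succ n ih =>
    intro v F
    rw [perm_sum_succ, alt, lap_ofFn]
    apply Finset.sum_congr rfl
    intro i _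
    rw [← ih]

lemma alt_sub (n : ℕ) : ∀ (L : List ℤ) (F G : List ℤ → NSym),
    alt n L (fun w => F w - G w) = alt n L F - alt n L G := by
  induction n with
  | zero => intro L F G; rfl
  | succ n ih => intro L F G; simp only [alt, ih, lap_sub]

lemma alt_mul (c : NSym) (n : ℕ) : ∀ (L : List ℤ) (F : List ℤ → NSym),
    alt n L (fun w => c * F w) = c * alt n L F := by
  induction n with
  | zero => intro L F; rfl
  | succ n ih => intro L F; simp only [alt, ih, lap_mul]

lemma alt_zero (n : ℕ) : ∀ (L : List ℤ), alt n L (fun _ => 0) = 0 := by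
  induction n with
  | zero => intro L; rfl
  | succ n ih => intro L; simp only [alt, ih, lap_zero]

lemma alt_DD (E : List ℤ) : ∀ A : List ℤ,
    alt E.length A (fun w => Hlist (List.zipWith (· + ·) E w)) = DD E A := by
  induction E with
  | nil => intro A; simp [alt, DD, Hlist]
  | cons e E ih =>
    intro A
    simp only [List.length_cons, alt, DD, ← ih, ← alt_mul]
    simp [Hlist]

/- Ribbons. -/

noncomputable def Rib : ℤ → List ℤ → NSym
  | b, [] => H b
  | b, c :: l => H b * Rib c l - Rib (b + c) l

lemma alt_Gp (E : List ℤ) : ∀ (b : ℤ) (A : List ℤ),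
    alt E.length A (fun w => if ∀ x ∈ List.zipWith (· + ·) E w, 0 < x then
      Rib b (List.zipWith (· + ·) E w) else 0) = Gp E b A := by
  induction E with
  | nil => intro b A; simp [alt, Gp, Rib]
  | cons e E ih =>
    intro b A
    simp only [List.length_cons, alt, Gp, ← ih, ← alt_mul, ← alt_sub]
    apply lap_congr
    intro a M _ _ _
    by_cases h : 0 < e + a
    · rw [if_pos h]
      congr 1
      funext w
      simp only [List.zipWith_cons_cons, List.forall_mem_cons, h, true_and, Rib]
      split_ifs <;> simp
    · rw [if_neg h]
      simp [h, alt_zero]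

lemma theta_insert (j : ℕ) (S : Finset ℕ) (n : ℕ) : ∀ (l : List ℤ) (i : ℕ), l.length = n → j < i →
    theta (insert j S) i l = theta S i l := by
  induction n with
  | zero => intro l i hl _; rw [List.length_eq_zero_iff.1 hl]; simp [theta]
  | succ n ih =>
    intro l i hl hj
    match l, hl with
    | [a], _ => simp [theta]
    | a :: b :: r, hl =>
      have : i ∈ insert j S ↔ i ∈ S := by simp; omega
      simp only [theta, this]
      simp at hl
      rw [ih _ _ (by simp; omega) (by omega), ih _ _ (by simp; omega) (by omega)]

lemma theta_length (S : Finset ℕ) (n : ℕ) : ∀ (l : List ℤ) (i : ℕ), l.length = n →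
    (theta S i l).length ≤ n := by
  induction n with
  | zero => intro l i hl; rw [List.length_eq_zero_iff.1 hl]; simp [theta]
  | succ n ih =>
    intro l i hl
    match l, hl with
    | [a], _ => simp [theta]
    | a :: b :: r, hl =>
      simp only [theta]
      simp at hl
      split_ifs
      · have := ih ((a + b) :: r) (i + 1) (by simp; omega)
        omega
      · have := ih (b :: r) (i + 1) (by simp; omega)
        simp; omega

lemma rib_sum (l : List ℤ) : ∀ (b : ℤ) (i : ℕ),
    ∑ S ∈ (Finset.Ico i (i + l.length)).powerset,
      (-1 : NSym) ^ (l.length + 1 - (theta S i (b :: l)).length) * Hlist (theta S i (b :: l))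
      = Rib b l := by
  induction l with
  | nil => intro b i; simp [theta, Hlist, Rib]
  | cons c l ih =>
    intro b i
    have hI : Finset.Ico i (i + (c :: l).length) =
        insert i (Finset.Ico (i + 1) (i + 1 + l.length)) := by
      ext x; simp; omega
    rw [hI, Finset.sum_powerset_insert (by simp), Rib, ← ih c (i + 1), ← ih (b + c) (i + 1),
      Finset.mul_sum, sub_eq_add_neg, ← Finset.sum_neg_distrib]
    congr 1
    · apply Finset.sum_congr rfl
      intro S hS
      have hi : i ∉ S := fun h => by
        have := Finset.mem_powerset.1 hS h
        simp at this
      simp only [theta, hi, if_false, List.length_cons, Nat.add_sub_add_right]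
      simp only [Hlist, List.map_cons, List.prod_cons]
      rw [← mul_assoc, ← mul_assoc, ((Commute.neg_one_left (H b)).pow_left _).eq]
    · apply Finset.sum_congr rfl
      intro S hS
      simp only [theta, Finset.mem_insert_self, if_true]
      rw [theta_insert _ _ _ _ _ rfl (by omega)]
      have := theta_length S (l.length + 1) ((b + c) :: l) (i + 1) (by simp)
      rw [List.length_cons, Nat.succ_sub this, pow_succ]
      simp

lemma Ribbon_cons (b : ℤ) (l : List ℤ) :
    Ribbon (b :: l) = if 0 < b then (if ∀ x ∈ l, 0 < x then Rib b l else 0) else 0 := by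
  have hI : Finset.Icc 1 ((b :: l).length - 1) = Finset.Ico 1 (1 + l.length) := by
    ext x; simp; omega
  rw [Ribbon, hI]
  have := rib_sum l b 1
  simp only [List.length_cons, List.forall_mem_cons] at this ⊢
  rw [this]
  split_ifs <;> simp_all

lemma alt_GG (e : ℤ) (E : List ℤ) (A : List ℤ) :
    alt (e :: E).length A (fun w => Ribbon (List.zipWith (· + ·) (e :: E) w)) = GG (e :: E) A := by
  simp only [List.length_cons, alt, GG, ← alt_Gp]
  apply lap_congr
  intro a M _ _ _
  simp only [List.zipWith_cons_cons, Ribbon_cons]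
  split_ifs
  · rfl
  · exact alt_zero _ _

lemma adm_range (k : ℕ) (α : ℕ → ℤ) (J : ℕ)
    (h1 : ∀ l, 1 ≤ l → l ≤ J → (l : ℤ) ≤ α l)
    (h2 : ∀ l, J + 1 ≤ l → l ≤ k → α l = (J : ℤ)) (n : ℕ) : ∀ s : ℕ, 1 ≤ s → s + n ≤ k + 1 →
    Adm (max 0 ((s : ℤ) - 1 - J)) ((List.range' s n).map fun l => α l - (l : ℤ)) := by
  induction n with
  | zero => intro s _ _; simp [Adm]
  | succ n ih =>
    intro s hs hk
    have := ih (s + 1) (by omega) (by omega)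
    simp only [List.range'_succ, List.map_cons, Adm]
    push_cast at this
    by_cases hJ : s ≤ J
    · left
      have h3 := h1 s hs hJ
      refine ⟨by omega, ?_⟩
      convert this using 1
      omega
    · right
      have h3 := h2 s (by omega) (by omega)
      refine ⟨by omega, ?_, ?_⟩
      · intro e' he'
        simp only [List.mem_map, List.mem_range'_1] at he'
        obtain ⟨l, hl, rfl⟩ := he'
        rw [h2 l (by omega) (by omega), h3]
        omega
      · convert this using 1
        omega

/-- **Theorem (ribbon expansion, staircase atop a rectangle).** If `α` is a composition
of positive integers for which there exists `J` with `1 ≤ J ≤ k` such that `α_ℓ ≥ ℓ`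
for `1 ≤ ℓ ≤ J` and `α_ℓ = J` for `J + 1 ≤ ℓ ≤ k`, then
`I_α = Σ_{σ ∈ S_k} sign(σ) R_{(α_1 − 1 + σ_1, …, α_k − k + σ_k)}`,
with the convention that `R_β = 0` whenever `β` has a part `≤ 0`. -/
theorem immaculate_ribbon_expansion (k : ℕ) (hk : 1 ≤ k) (α : ℕ → ℤ)
    (hpos : ∀ i, 1 ≤ i → i ≤ k → 0 < α i)
    (J : ℕ) (hJ1 : 1 ≤ J) (hJk : J ≤ k)
    (h1 : ∀ l, 1 ≤ l → l ≤ J → (l : ℤ) ≤ α l)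
    (h2 : ∀ l, J + 1 ≤ l → l ≤ k → α l = (J : ℤ)) :
    Imm k α = ∑ σ : Equiv.Perm (Fin k),
      (Equiv.Perm.sign σ : ℤ) •
        Ribbon (List.ofFn fun r : Fin k =>
          α (r.1 + 1) - ((r.1 : ℤ) + 1) + (((σ r : ℕ) : ℤ) + 1)) := by
  obtain ⟨n, rfl⟩ : ∃ n, k = n + 1 := ⟨k - 1, by omega⟩
  set e : ℕ → ℤ := fun l => α l - (l : ℤ) with he
  set E : List ℤ := (List.range' 2 n).map e with hE
  set A : List ℤ := List.ofFn (fun j : Fin (n + 1) => ((j : ℕ) : ℤ) + 1) with hA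
  have hlen : (e 1 :: E).length = n + 1 := by simp [hE]
  have hEl : e 1 :: E = List.ofFn (fun r : Fin (n + 1) => e (r.1 + 1)) := by
    apply List.ext_getElem
    · simp [hE]
    · intro i hi1 hi2
      cases i with
      | zero => simp
      | succ i => simp [hE]; congr 1; omega
  have hz : ∀ σ : Equiv.Perm (Fin (n + 1)),
      List.zipWith (· + ·) (e 1 :: E) (List.ofFn fun i => (((σ i : Fin (n + 1)) : ℕ) : ℤ) + 1) =
      List.ofFn fun r : Fin (n + 1) =>
          α (r.1 + 1) - ((r.1 : ℤ) + 1) + (((σ r : ℕ) : ℤ) + 1) := by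
    intro σ
    rw [hEl]
    apply List.ext_getElem
    · simp
    · intro i hi1 hi2
      simp only [List.getElem_zipWith, List.getElem_ofFn, he]
      push_cast
      rfl
  have hR := alt_perm (n + 1) (fun j : Fin (n + 1) => ((j : ℕ) : ℤ) + 1)
    (fun w => Ribbon (List.zipWith (· + ·) (e 1 :: E) w))
  have hL := alt_perm (n + 1) (fun j : Fin (n + 1) => ((j : ℕ) : ℤ) + 1)
    (fun w => Hlist (List.zipWith (· + ·) (e 1 :: E) w))
  simp only [hz] at hR hL
  rw [hR, ← hA]
  have hI : Imm (n + 1) α = alt (n + 1) A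
      (fun w => Hlist (List.zipWith (· + ·) (e 1 :: E) w)) := by
    rw [← hL, Imm, ndet]
    apply Finset.sum_congr rfl
    intro σ _
    rw [Hlist, List.map_ofFn]
    congr 3
    funext i
    simp only [Function.comp]
    congr 1
    ring
  rw [hI, ← hlen, alt_DD, alt_GG]
  symm
  apply GG_eq_DD
  · have := h1 1 le_rfl hJ1
    simp [he]; simpa using this
  · have := adm_range (n + 1) α J h1 h2 n 2 (by omega) (by omega)
    convert this using 1
    omega
  · rw [hA, List.pairwise_ofFn]
    intro i j hij
    have : (i : ℕ) < j := hij
    omega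
  · intro a ha
    rw [hA, List.mem_ofFn] at ha
    obtain ⟨i, rfl⟩ := ha
    omega
  · simp [hA, hE]
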